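/- Fix norms ‖·‖_(r) on V_r (r ∈ ℕ₆). Let ε : ℕ₆ → (0, ∞) with ε(r) → 0, let α, β > 0, let k ≥ 1, and let A(1) ⊆ A(k) ⊆ A(k+1) be subsets of ℕ₆. Assume that for every j ∈ A(k+1) there is a map ξ_j : L(R_{A(k+1)}) → ℝ such that: (a) if T ∈ L(R_{A(k+1)}) and μ ∈ ℝ satisfy π_j^W(Tw) = μw for all w ∈ W_j, then ξ_j(T) = μ; (b) |ξ_j(TS) − ξ_j(T)ξ_j(S)| ≤ α·j^(−β)·‖T‖·‖S‖ for all T, S; (c) if j, j+1 ∈ A(k+1) then |ξ_{j+1}(T) − ξ_j(T)| ≤ ε(j+1)·‖T‖ for all T. Assume moreover that for every r ∈ ℕ₆ there exist j > r and i > j with j ∈ A(1), i ∉ A(k), and {j, j+1, …, i} ⊆ A(k+1). Then there is no bounded linear projection Q on R_{A(k+1)} (Q² = Q) with R_{A(1)} ⊆ range(Q) ⊆ R_{A(k)}. -/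

import Mathlib

open scoped Classical

noncomputable section

/-- `a_r = 5·10^(r−2)`. -/
def aIdx (r : ℕ) : ℕ := 5 * 10 ^ (r - 2)

/-- `b_r = 10^r`. -/
def bIdx (r : ℕ) : ℕ := 10 ^ r

/-- The index set of the subspace `V_r = lin{e_i : a_r < i ≤ b_r}`. -/
def VIdx (r : ℕ) : Set ℕ := {i | aIdx r < i ∧ i ≤ bIdx r}

/-- The index set of the subspace `W_r = lin{e_i : a_{r+1} < i ≤ b_r}`. -/
def WIdx (r : ℕ) : Set ℕ := {i | aIdx (r + 1) < i ∧ i ≤ bIdx r}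

/-- The index set `E(r)`. -/
def EIdx (r : ℕ) : Set ℕ :=
  if r = 6 then {i | aIdx 6 < i ∧ i ≤ bIdx 6} else {i | bIdx (r - 1) < i ∧ i ≤ bIdx r}

/-- The vector space `V` with basis `{e_i : i > a_6}`, realized as the space of finitely
supported real families indexed by `{i : ℕ // a_6 < i}`. -/
abbrev Vb : Type := {i : ℕ // aIdx 6 < i} →₀ ℝ

/-- `x ∈ V` is supported in the index set `s ⊆ ℕ`. -/
def SuppIn (x : Vb) (s : Set ℕ) : Prop := ∀ i, x i ≠ 0 → (i : ℕ) ∈ s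

/-- The coordinate projection of `V` onto the coordinates lying in `s` (e.g. `π_r^V`, `π_r^W`
for `s = VIdx r`, `WIdx r`). -/
def projTo (s : Set ℕ) : Vb →ₗ[ℝ] Vb where
  toFun x := Finsupp.onFinset x.support (fun i => if (i : ℕ) ∈ s then x i else 0)
    (fun i h => Finsupp.mem_support_iff.2 (fun hx => h (by simp [hx])))
  map_add' x y := by
    ext i
    by_cases h : (i : ℕ) ∈ s <;> simp [Finsupp.onFinset_apply, h]
  map_smul' c x := by
    ext i
    by_cases h : (i : ℕ) ∈ s <;> simp [Finsupp.onFinset_apply, h]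

/-- `N` is a norm on the coordinate subspace of `V` supported in `s`. -/
structure IsNormOn (N : Vb → ℝ) (s : Set ℕ) : Prop where
  nonneg : ∀ x, SuppIn x s → 0 ≤ N x
  eq_zero_iff : ∀ x, SuppIn x s → N x = 0 → x = 0
  add_le : ∀ x y, SuppIn x s → SuppIn y s → N (x + y) ≤ N x + N y
  smul : ∀ (c : ℝ) (x), SuppIn x s → N (c • x) = |c| * N x

/-- A collection of norms `‖·‖_(r)` on the spaces `V_r`, `r ∈ ℕ₆`. -/
def NormFamily (N : ℕ → Vb → ℝ) : Prop := ∀ r, 6 ≤ r → IsNormOn (N r) (VIdx r)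

/-- The norm on `V` induced by the collection `N`:
`‖x‖² = Σ_{r≥6} [‖π_r^V x‖_(r)² + (1/log r)(‖π_r^W x‖_(r)² + ‖π_r^W x‖_(r+1)²)]`. -/
def VNorm (N : ℕ → Vb → ℝ) (x : Vb) : ℝ :=
  Real.sqrt (∑' r : ℕ,
    if 6 ≤ r then
      N r (projTo (VIdx r) x) ^ 2 +
        (1 / Real.log r) *
          (N r (projTo (WIdx r) x) ^ 2 + N (r + 1) (projTo (WIdx r) x) ^ 2)
    else 0)

/-- The unique block `j ∈ ℕ₆` with `i ∈ E(j)` (for `i > a_6`). -/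
def blockOf (i : ℕ) : ℕ := max 6 (Nat.clog 10 i)

/-- The multiplier `M_f`, acting on `e_i` as multiplication by `f(j)` for `i ∈ E(j)`. -/
def Mf (f : ℕ → ℝ) : Vb →ₗ[ℝ] Vb where
  toFun x := Finsupp.onFinset x.support (fun i => f (blockOf i) * x i)
    (fun i h => Finsupp.mem_support_iff.2 (fun hx => h (by simp [hx])))
  map_add' x y := by
    ext i
    simp [Finsupp.onFinset_apply, mul_add]
  map_smul' c x := by
    ext i
    simp [Finsupp.onFinset_apply]
    ring

/-- The closed linear span `R_A` in `R` of the basis vectors `e_i`, `i ∈ ∪_{j∈A} E(j)`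
(where `R` is a realization of the completion of `V` via a dense isometric embedding
`eV : V → R`). -/
def RA {R : Type} [NormedAddCommGroup R] [NormedSpace ℝ R] (eV : Vb →ₗ[ℝ] R) (A : Set ℕ) :
    Submodule ℝ R :=
  (Submodule.span ℝ (⇑eV '' {v : Vb | SuppIn v (⋃ j ∈ A, EIdx j)})).topologicalClosure

theorem WIdx_subset_EIdx {j : ℕ} (hj : 6 ≤ j) : WIdx j ⊆ EIdx j := by
  rintro n ⟨h1, h2⟩
  obtain ⟨m, rfl⟩ : ∃ m, j = m + 1 := ⟨j - 1, by omega⟩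
  have h3 : 5 * 10 ^ m < n := by simpa [aIdx] using h1
  unfold EIdx
  split_ifs with h
  · obtain rfl : m = 5 := by omega
    exact ⟨by norm_num [aIdx] at h3 ⊢; omega, h2⟩
  · refine ⟨?_, h2⟩
    simp only [bIdx, Nat.add_sub_cancel]
    omega

theorem disjoint_WIdx_EIdx {i j : ℕ} (hi : 6 ≤ i) (hij : i ≠ j) :
    Disjoint (WIdx i) (EIdx j) := by
  refine Set.disjoint_left.2 ?_
  rintro n ⟨h1, h2⟩ hE
  have h3 : 5 * 10 ^ (i - 1) < n := h1
  have hle : n ≤ 10 ^ j := by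
    unfold EIdx at hE
    split_ifs at hE with h
    · exact h ▸ hE.2
    · exact hE.2
  rcases lt_or_gt_of_ne hij with hlt | hgt
  · have hlow : 10 ^ (j - 1) < n := by
      unfold EIdx at hE
      rw [if_neg (by omega)] at hE
      exact hE.1
    have := Nat.pow_le_pow_right (n := 10) (by norm_num) (show i ≤ j - 1 by omega)
    have h2' : n ≤ 10 ^ i := h2
    omega
  · have := Nat.pow_le_pow_right (n := 10) (by norm_num) (show j ≤ i - 1 by omega)
    omega

theorem projTo_apply (s : Set ℕ) (v : Vb) (i : {i : ℕ // aIdx 6 < i}) :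
    projTo s v i = if (i : ℕ) ∈ s then v i else 0 := rfl

theorem projTo_eq_self {s : Set ℕ} {v : Vb} (hv : SuppIn v s) : projTo s v = v := by
  ext i
  rw [projTo_apply]
  split_ifs with h
  · rfl
  · exact (not_not.1 (mt (hv i) h)).symm

theorem projTo_eq_zero {s t : Set ℕ} (hst : Disjoint s t) {v : Vb} (hv : SuppIn v t) :
    projTo s v = 0 := by
  ext i
  rw [projTo_apply]
  split_ifs with h
  · exact not_not.1 (mt (hv i) (Set.disjoint_left.1 hst h))
  · rfl

section RA

variable {R : Type} [NormedAddCommGroup R] [NormedSpace ℝ R] {eV : Vb →ₗ[ℝ] R}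

theorem mem_RA_of_suppIn_WIdx {A : Set ℕ} {j : ℕ} (hj : 6 ≤ j) (hjA : j ∈ A) {v : Vb}
    (hv : SuppIn v (WIdx j)) : eV v ∈ RA eV A :=
  Submodule.le_topologicalClosure _ <| Submodule.subset_span
    ⟨v, fun i hi => Set.mem_biUnion hjA (WIdx_subset_EIdx hj (hv i hi)), rfl⟩

theorem eq_zero_of_mem_RA {A : Set ℕ} {i : ℕ} (hi : 6 ≤ i) (hiA : i ∉ A) {P : R →L[ℝ] R}
    (hP : ∀ v : Vb, P (eV v) = eV (projTo (WIdx i) v)) {x : R} (hx : x ∈ RA eV A) :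
    P x = 0 := by
  suffices h : RA eV A ≤ LinearMap.ker P.toLinearMap from h hx
  refine Submodule.topologicalClosure_minimal _ (Submodule.span_le.2 ?_) P.isClosed_ker
  rintro _ ⟨v, hv, rfl⟩
  have hdisj : Disjoint (WIdx i) (⋃ j ∈ A, EIdx j) :=
    Set.disjoint_iUnion₂_right.2 fun j hj =>
      disjoint_WIdx_EIdx hi fun h => hiA (h ▸ hj)
  change P (eV v) = 0
  rw [hP, projTo_eq_zero hdisj hv, map_zero]

end RA

/-- A real sequence that starts at `1`, ends at `0` and moves in steps shorter than `1 / 4`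
takes a value in `[1 / 4, 1 / 2]`. -/
theorem exists_mem_Icc_of_small_steps {f : ℕ → ℝ} {j i : ℕ} (hji : j ≤ i) (hj : f j = 1)
    (hi : f i = 0) (hstep : ∀ m, j ≤ m → m < i → |f (m + 1) - f m| < 1 / 4) :
    ∃ m ∈ Set.Icc j i, f m ∈ Set.Icc (1 / 4 : ℝ) (1 / 2) := by
  by_contra! hne
  have hlarge : ∀ m, j ≤ m → m ≤ i → 1 / 2 < f m := by
    intro m hjm
    induction m, hjm using Nat.le_induction with
    | base => intro _; rw [hj]; norm_num
    | succ m hjm ih =>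
      intro hmi
      by_contra! hle
      have := (abs_lt.1 (hstep m hjm hmi)).1
      exact hne (m + 1) ⟨by omega, hmi⟩ ⟨by linarith [ih (by omega)], hle⟩
  have := hlarge i hji le_rfl
  rw [hi] at this
  norm_num at this

/-- Let `R` be a realization of the completion of `(V, ‖·‖)`, let
`A(1) ⊆ A(k) ⊆ A(k+1) ⊆ ℕ₆`, and suppose maps `ξ_j : L(R_{A(k+1)}) → ℝ` (`j ∈ A(k+1)`)
satisfy conditions (a), (b), (c) of Theorem 2, while for every `r ∈ ℕ₆` there are `j > r`
and `i > j` with `j ∈ A(1)`, `i ∉ A(k)` and `{j, …, i} ⊆ A(k+1)`. Then there is no bounded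
linear projection `Q` on `R_{A(k+1)}` with `R_{A(1)} ⊆ range Q ⊆ R_{A(k)}`. -/
theorem statement12 (N : ℕ → Vb → ℝ) (hN : NormFamily N)
    (ε : ℕ → ℝ) (hεpos : ∀ r, 6 ≤ r → 0 < ε r)
    (hε0 : Filter.Tendsto ε Filter.atTop (nhds 0))
    (α β : ℝ) (hα : 0 < α) (hβ : 0 < β) (k : ℕ) (hk : 1 ≤ k)
    (A1 Ak Ak1 : Set ℕ) (hA1 : A1 ⊆ Ak) (hAk : Ak ⊆ Ak1) (hAk1 : Ak1 ⊆ {r : ℕ | 6 ≤ r})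
    (R : Type) [NormedAddCommGroup R] [NormedSpace ℝ R] [CompleteSpace R]
    (eV : Vb →ₗ[ℝ] R) (hiso : ∀ x, ‖eV x‖ = VNorm N x) (hdense : DenseRange eV)
    (ξ : ℕ → ((RA eV Ak1 →L[ℝ] RA eV Ak1) → ℝ))
    -- (a)
    (hξa : ∀ j ∈ Ak1, ∃ Pj : R →L[ℝ] R, (∀ v : Vb, Pj (eV v) = eV (projTo (WIdx j) v)) ∧
      ∀ (T : RA eV Ak1 →L[ℝ] RA eV Ak1) (μ : ℝ),
        (∀ (v : Vb), SuppIn v (WIdx j) → ∀ (hw : eV v ∈ RA eV Ak1),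
          Pj (T ⟨eV v, hw⟩ : R) = μ • eV v) →
        ξ j T = μ)
    -- (b)
    (hξb : ∀ j ∈ Ak1, ∀ T S : RA eV Ak1 →L[ℝ] RA eV Ak1,
      |ξ j (T.comp S) - ξ j T * ξ j S| ≤ α * (j : ℝ) ^ (-β) * ‖T‖ * ‖S‖)
    -- (c)
    (hξc : ∀ j ∈ Ak1, (j + 1) ∈ Ak1 →
      ∀ T : RA eV Ak1 →L[ℝ] RA eV Ak1, |ξ (j + 1) T - ξ j T| ≤ ε (j + 1) * ‖T‖)
    -- the combinatorial condition (d) of Lemma 2: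
    (hcomb : ∀ r, 6 ≤ r →
      ∃ j i, r < j ∧ j ∈ A1 ∧ j < i ∧ i ∉ Ak ∧ Set.Icc j i ⊆ Ak1) :
    ¬ ∃ Q : RA eV Ak1 →L[ℝ] RA eV Ak1, Q.comp Q = Q ∧
        (∀ x : R, x ∈ RA eV A1 → ∃ y, (Q y : R) = x) ∧
        (∀ y, (Q y : R) ∈ RA eV Ak) := by
  rintro ⟨Q, hQ, hA1Q, hQAk⟩
  have hεQ : Filter.Tendsto (fun j : ℕ => ε j * ‖Q‖) Filter.atTop (nhds 0) := by
    simpa using hε0.mul_const ‖Q‖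
  have hβQ : Filter.Tendsto (fun j : ℕ => α * (j : ℝ) ^ (-β) * ‖Q‖ * ‖Q‖)
      Filter.atTop (nhds 0) := by
    simpa using ((((tendsto_rpow_neg_atTop hβ).comp tendsto_natCast_atTop_atTop).const_mul
      α).mul_const ‖Q‖).mul_const ‖Q‖
  obtain ⟨r, hr⟩ := Filter.eventually_atTop.1
    ((hεQ.eventually_lt_const (show (0 : ℝ) < 1 / 4 by norm_num)).and
      (hβQ.eventually_lt_const (show (0 : ℝ) < 1 / 8 by norm_num)))
  obtain ⟨j, i, hrj, hjA, hji, hiA, hIcc⟩ := hcomb (max r 6) (le_max_right _ _)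
  have hj6 : 6 ≤ j := by omega
  have hjA' : j ∈ Ak1 := hAk (hA1 hjA)
  have hiA' : i ∈ Ak1 := hIcc ⟨hji.le, le_rfl⟩
  have hξj : ξ j Q = 1 := by
    obtain ⟨P, hP, hPξ⟩ := hξa j hjA'
    refine hPξ Q 1 fun v hv hw => ?_
    obtain ⟨y, hy⟩ := hA1Q _ (mem_RA_of_suppIn_WIdx hj6 hjA hv)
    have hQy : Q y = ⟨eV v, hw⟩ := Subtype.ext hy
    have hQQ : Q (Q y) = Q y := DFunLike.congr_fun hQ y
    rw [← hQy, hQQ, hy, hP, projTo_eq_self hv, one_smul]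
  have hξi : ξ i Q = 0 := by
    obtain ⟨P, hP, hPξ⟩ := hξa i hiA'
    refine hPξ Q 0 fun v _ hw => ?_
    rw [eq_zero_of_mem_RA (by omega) hiA hP (hQAk _), zero_smul]
  obtain ⟨m, hm, hm1, hm2⟩ :=
    exists_mem_Icc_of_small_steps (f := fun m => ξ m Q) hji.le hξj hξi fun m hjm hmi =>
      (hξc m (hIcc ⟨hjm, hmi.le⟩) (hIcc ⟨by omega, hmi⟩) Q).trans_lt (hr (m + 1) (by omega)).1
  have hb := hξb m (hIcc hm) Q Q
  rw [hQ] at hb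
  have hsmall := (abs_le.1 hb).2.trans_lt (hr m (by have := hm.1; omega)).2
  nlinarith [mul_nonneg (sub_nonneg.2 hm1) (sub_nonneg.2 hm2)]
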